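/- For every C > 0 and every ε > 0 there exist δ > 0 and N such that for all n ≥ N and all integers k with |k − 2·log₂ n| ≤ C·log log n and C(n,k)·2^{−C(k,2)} ≤ n^{1+δ}: the probability that some (k+2)-element vertex subset of G_{n,1/2} induces at most k^{3/4} edges is at most n^{−1+ε}. -/

import Mathlib

open scoped Classical

/-- Probability of an event under the uniform measure on simple graphs on `Fin n`
(equivalently, `G_{n,1/2}`). -/
noncomputable def grPr (n : ℕ) (S : Set (SimpleGraph (Fin n))) : ℝ :=
  ((PMF.uniformOfFintype (SimpleGraph (Fin n))).toOuterMeasure S).toReal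

/-- Number of edges of `G` with both endpoints in `s`. -/
noncomputable def edgesIn {n : ℕ} (G : SimpleGraph (Fin n)) (s : Finset (Fin n)) : ℕ :=
  {e ∈ G.edgeSet | ∀ v ∈ e, v ∈ s}.ncard

/-- `E[Y_k] = C(n,k)·2^{-C(k,2)}`. -/
noncomputable def expY (n k : ℕ) : ℝ := (n.choose k : ℝ) / 2 ^ (k.choose 2)

/-- The pairs of distinct elements of `s`. -/
noncomputable def pairsIn {n : ℕ} (s : Finset (Fin n)) : Finset (Sym2 (Fin n)) :=
  s.sym2.filter fun e => ¬ e.IsDiag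

theorem mem_pairsIn {n : ℕ} {s : Finset (Fin n)} {e : Sym2 (Fin n)} :
    e ∈ pairsIn s ↔ (∀ v ∈ e, v ∈ s) ∧ ¬ e.IsDiag := by
  simp [pairsIn, Finset.mem_sym2_iff]

theorem card_pairsIn {n : ℕ} (s : Finset (Fin n)) : (pairsIn s).card = s.card.choose 2 := by
  rw [← Sym2.card_image_offDiag]
  congr 1
  ext e
  induction e with
  | _ a b =>
    simp only [mem_pairsIn, Sym2.mem_iff, Sym2.mk_isDiag_iff, Finset.mem_image,
      Finset.mem_offDiag, Prod.exists]
    constructor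
    · rintro ⟨h, hab⟩
      exact ⟨a, b, ⟨h a (Or.inl rfl), h b (Or.inr rfl), hab⟩, rfl⟩
    · rintro ⟨x, y, ⟨hx, hy, hxy⟩, h⟩
      rcases Sym2.eq_iff.1 h with ⟨rfl, rfl⟩ | ⟨rfl, rfl⟩
      · exact ⟨by rintro v (rfl | rfl) <;> assumption, hxy⟩
      · exact ⟨by rintro v (rfl | rfl) <;> assumption, Ne.symm hxy⟩

theorem pairsIn_subset_univ {n : ℕ} (s : Finset (Fin n)) :
    pairsIn s ⊆ pairsIn (Finset.univ : Finset (Fin n)) := fun _ he =>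
  mem_pairsIn.2 ⟨fun _ _ => Finset.mem_univ _, (mem_pairsIn.1 he).2⟩

theorem two_pow_le_card_simpleGraph (n : ℕ) :
    2 ^ n.choose 2 ≤ Nat.card (SimpleGraph (Fin n)) := by
  have h : (pairsIn (Finset.univ : Finset (Fin n))).powerset.card = 2 ^ n.choose 2 := by
    rw [Finset.card_powerset, card_pairsIn, Finset.card_fin]
  rw [← h, Nat.card_eq_fintype_card, ← Finset.card_univ]
  refine Finset.card_le_card_of_injOn
    (fun A : Finset (Sym2 (Fin n)) => SimpleGraph.fromEdgeSet (A : Set (Sym2 (Fin n))))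
    (fun _ _ => Finset.mem_coe.2 (Finset.mem_univ _)) ?_
  have key : ∀ A ∈ (pairsIn (Finset.univ : Finset (Fin n))).powerset,
      (SimpleGraph.fromEdgeSet (A : Set (Sym2 (Fin n)))).edgeSet = A := by
    intro A hA
    rw [SimpleGraph.edgeSet_fromEdgeSet]
    ext e
    simp only [Set.mem_sdiff, Finset.mem_coe]
    refine ⟨fun h => h.1, fun h => ⟨h, fun hd => ?_⟩⟩
    exact (mem_pairsIn.1 (Finset.mem_powerset.1 hA h)).2 (by simpa using hd)
  intro A hA B hB hAB
  have := congrArg SimpleGraph.edgeSet hAB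
  simp only [key A hA, key B hB] at this
  exact_mod_cast this

theorem edgesIn_eq_card {n : ℕ} (G : SimpleGraph (Fin n)) (s : Finset (Fin n)) :
    edgesIn G s = (G.edgeFinset ∩ pairsIn s).card := by
  rw [edgesIn, ← Set.ncard_coe_finset]
  congr 1
  ext e
  simp only [Set.mem_ofPred_eq, Finset.coe_inter, SimpleGraph.coe_edgeFinset, Set.mem_inter_iff,
    Finset.mem_coe, mem_pairsIn]
  exact ⟨fun h => ⟨h.1, h.2, G.not_isDiag_of_mem_edgeSet h.1⟩, fun h => ⟨h.1, h.2.1⟩⟩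

theorem card_powerset_filter_card_le {α : Type*} (E : Finset α) (m : ℕ) :
    (E.powerset.filter fun T => T.card ≤ m).card ≤ (E.card + 1) ^ m := by
  have hsub : (E.powerset.filter fun T => T.card ≤ m) ⊆
      (Finset.range (m + 1)).biUnion fun j => E.powersetCard j := by
    intro T hT
    simp only [Finset.mem_filter, Finset.mem_powerset] at hT
    simp only [Finset.mem_biUnion, Finset.mem_range, Finset.mem_powersetCard]
    exact ⟨T.card, by omega, hT.1, rfl⟩
  refine (Finset.card_le_card hsub).trans (Finset.card_biUnion_le.trans ?_)
  rw [add_pow]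
  refine Finset.sum_le_sum fun j hj => ?_
  rw [Finset.card_powersetCard, one_pow, mul_one]
  have : 0 < m.choose j := Nat.choose_pos (by simpa [Nat.lt_succ_iff] using hj)
  exact (Nat.choose_le_pow _ _).trans (Nat.le_mul_of_pos_right _ this)

theorem card_filter_edgesIn_le {n : ℕ} (s : Finset (Fin n)) (m : ℕ) :
    (Finset.univ.filter fun G : SimpleGraph (Fin n) => edgesIn G s ≤ m).card ≤
      (s.card.choose 2 + 1) ^ m * 2 ^ (n.choose 2 - s.card.choose 2) := by
  have hcard : (((pairsIn s).powerset.filter fun T => T.card ≤ m) ×ˢ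
      (pairsIn (Finset.univ : Finset (Fin n)) \ pairsIn s).powerset).card ≤
      (s.card.choose 2 + 1) ^ m * 2 ^ (n.choose 2 - s.card.choose 2) := by
    rw [Finset.card_product, Finset.card_powerset,
      Finset.card_sdiff_of_subset (pairsIn_subset_univ s), card_pairsIn, Finset.card_fin,
      card_pairsIn]
    refine Nat.mul_le_mul_right _ ?_
    have := card_powerset_filter_card_le (pairsIn s) m
    rwa [card_pairsIn] at this
  refine le_trans (Finset.card_le_card_of_injOn
    (fun G : SimpleGraph (Fin n) => (G.edgeFinset ∩ pairsIn s, G.edgeFinset \ pairsIn s))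
    ?_ ?_) hcard
  · intro G hG
    have hG' : edgesIn G s ≤ m := by simpa using hG
    simp only [Finset.coe_product, Set.mem_prod, Finset.mem_coe, Finset.mem_filter,
      Finset.mem_powerset]
    refine ⟨⟨Finset.inter_subset_right, edgesIn_eq_card G s ▸ hG'⟩,
      Finset.sdiff_subset_sdiff (fun e he => ?_) subset_rfl⟩
    exact mem_pairsIn.2 ⟨fun _ _ => Finset.mem_univ _,
      G.not_isDiag_of_mem_edgeSet (SimpleGraph.mem_edgeFinset.1 he)⟩
  · intro G _ H _ h
    simp only [Prod.mk.injEq] at h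
    have : G.edgeFinset = H.edgeFinset := by
      rw [← Finset.sdiff_union_inter G.edgeFinset (pairsIn s),
        ← Finset.sdiff_union_inter H.edgeFinset (pairsIn s), h.1, h.2]
    exact SimpleGraph.edgeFinset_inj.1 this

theorem grPr_exists_edgesIn_le (n t m : ℕ) :
    grPr n {G | ∃ S : Finset (Fin n), S.card = t ∧ edgesIn G S ≤ m} ≤
      (n.choose t : ℝ) * (t.choose 2 + 1 : ℝ) ^ m / 2 ^ t.choose 2 := by
  have hpr : ∀ A : Set (SimpleGraph (Fin n)),
      grPr n A = (Nat.card A : ℝ) / Nat.card (SimpleGraph (Fin n)) := by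
    intro A
    rw [grPr, PMF.toOuterMeasure_uniformOfFintype_apply, ENNReal.toReal_div,
      ENNReal.toReal_natCast, ENNReal.toReal_natCast, Nat.card_eq_fintype_card,
      Nat.card_eq_fintype_card]
  rcases lt_or_ge n t with hnt | hnt
  · have : {G : SimpleGraph (Fin n) | ∃ S : Finset (Fin n), S.card = t ∧ edgesIn G S ≤ m} = ∅ := by
      refine Set.eq_empty_of_forall_notMem fun G => ?_
      rintro ⟨S, hS, -⟩
      have := S.card_le_univ
      rw [Fintype.card_fin] at this
      omega
    rw [this, hpr]
    rw [Nat.card_coe_set_eq, Set.ncard_empty, Nat.cast_zero, zero_div]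
    positivity
  have hcount : Nat.card {G : SimpleGraph (Fin n) |
      ∃ S : Finset (Fin n), S.card = t ∧ edgesIn G S ≤ m} ≤
      n.choose t * ((t.choose 2 + 1) ^ m * 2 ^ (n.choose 2 - t.choose 2)) := by
    have hsub : (Finset.univ.filter fun G : SimpleGraph (Fin n) =>
        ∃ S : Finset (Fin n), S.card = t ∧ edgesIn G S ≤ m) ⊆
        (Finset.powersetCard t (Finset.univ : Finset (Fin n))).biUnion fun S =>
          Finset.univ.filter fun G : SimpleGraph (Fin n) => edgesIn G S ≤ m := by
      intro G hG
      simpa [Finset.mem_powersetCard] using hG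
    have h := (Finset.card_le_card hsub).trans (Finset.card_biUnion_le_card_mul _ _
      ((t.choose 2 + 1) ^ m * 2 ^ (n.choose 2 - t.choose 2)) fun S hS => by
        have := card_filter_edgesIn_le S m
        rwa [(Finset.mem_powersetCard.1 hS).2] at this)
    rw [Finset.card_powersetCard, Finset.card_fin] at h
    rw [← Set.ncard_coe_finset] at h
    rw [Nat.card_coe_set_eq]
    simpa using h
  rw [hpr]
  have htn : t.choose 2 ≤ n.choose 2 := Nat.choose_le_choose 2 hnt
  have hcount' : (Nat.card {G : SimpleGraph (Fin n) |
      ∃ S : Finset (Fin n), S.card = t ∧ edgesIn G S ≤ m} : ℝ) ≤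
      n.choose t * ((t.choose 2 + 1) ^ m * 2 ^ (n.choose 2 - t.choose 2)) := by
    exact_mod_cast hcount
  have htot : (2 : ℝ) ^ n.choose 2 ≤ Nat.card (SimpleGraph (Fin n)) := by
    exact_mod_cast two_pow_le_card_simpleGraph n
  have hpow : (2 : ℝ) ^ n.choose 2 = 2 ^ (n.choose 2 - t.choose 2) * 2 ^ t.choose 2 := by
    rw [← pow_add, Nat.sub_add_cancel htn]
  calc _ ≤ (n.choose t * ((t.choose 2 + 1) ^ m * 2 ^ (n.choose 2 - t.choose 2)) : ℝ) /
        2 ^ n.choose 2 := by gcongr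
    _ = _ := by rw [hpow]; field_simp

theorem choose_add_two_div_le (n k : ℕ) :
    (n.choose (k + 2) : ℝ) / 2 ^ (k + 2).choose 2 ≤ expY n k * (n : ℝ) ^ 2 / 2 ^ (2 * k) := by
  have hstep : ∀ j, n.choose (j + 1) ≤ n.choose j * n := fun j => by
    calc n.choose (j + 1) ≤ n.choose (j + 1) * (j + 1) := Nat.le_mul_of_pos_right _ (by omega)
      _ = n.choose j * (n - j) := Nat.choose_succ_right_eq n j
      _ ≤ _ := Nat.mul_le_mul_left _ (Nat.sub_le _ _)
  have h1 : n.choose (k + 2) ≤ n.choose k * n ^ 2 := by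
    calc _ ≤ n.choose (k + 1) * n := hstep (k + 1)
      _ ≤ n.choose k * n * n := Nat.mul_le_mul_right _ (hstep k)
      _ = _ := by ring
  have h2 : (k + 2).choose 2 = k.choose 2 + 2 * k + 1 := by
    have a := Nat.choose_succ_succ (k + 1) 1
    have b := Nat.choose_succ_succ k 1
    simp only [Nat.choose_one_right, Nat.succ_eq_add_one, Nat.reduceAdd, add_assoc] at a b
    omega
  have h1' : (n.choose (k + 2) : ℝ) ≤ n.choose k * (n : ℝ) ^ 2 := by exact_mod_cast h1
  calc (n.choose (k + 2) : ℝ) / 2 ^ (k + 2).choose 2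
      ≤ (n.choose k * (n : ℝ) ^ 2) / 2 ^ (k.choose 2 + 2 * k) := by
        have hpow : (2 : ℝ) ^ (k.choose 2 + 2 * k) ≤ 2 ^ (k.choose 2 + 2 * k + 1) :=
          pow_le_pow_right₀ (by norm_num) (Nat.le_succ _)
        rw [h2]
        gcongr
    _ = _ := by rw [expY, pow_add]; field_simp

open Filter Asymptotics in
theorem eventually_rpow_mul_log_add_log_le (c ε : ℝ) (hε : 0 < ε) :
    ∀ᶠ x : ℝ in atTop,
      2 * (4 * x) ^ (3 / 4 : ℝ) * Real.log (4 * x + 2) + c * Real.log x ≤ ε * x := by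
  have hlin : Tendsto (fun x : ℝ => 4 * x + 2) atTop atTop :=
    tendsto_atTop_add_const_right _ _ (tendsto_id.const_mul_atTop (by norm_num))
  have h1 : (fun x : ℝ => Real.log (4 * x + 2)) =o[atTop]
      fun x : ℝ => (4 * x + 2) ^ (1 / 4 : ℝ) :=
    (isLittleO_log_rpow_atTop (by norm_num)).comp_tendsto hlin
  have h2 := h1.def (show 0 < ε / 40 by positivity)
  have h3 := (Real.isLittleO_log_id_atTop.const_mul_left c).def (show 0 < ε / 2 by positivity)
  filter_upwards [h2, h3, eventually_ge_atTop 1] with x hx2 hx3 hx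
  have hl : 0 ≤ Real.log (4 * x + 2) := Real.log_nonneg (by linarith)
  rw [Real.norm_of_nonneg hl, Real.norm_of_nonneg (by positivity)] at hx2
  simp only [id, Real.norm_eq_abs, abs_of_nonneg (show 0 ≤ x by linarith)] at hx3
  have h4 : (4 * x) ^ (3 / 4 : ℝ) ≤ (4 * x + 2) ^ (3 / 4 : ℝ) :=
    Real.rpow_le_rpow (by linarith) (by linarith) (by norm_num)
  have h5 : (4 * x + 2) ^ (3 / 4 : ℝ) * (4 * x + 2) ^ (1 / 4 : ℝ) = 4 * x + 2 := by
    rw [← Real.rpow_add (by linarith)]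
    norm_num
  have h6 : (4 * x) ^ (3 / 4 : ℝ) * Real.log (4 * x + 2) ≤ ε / 40 * (4 * x + 2) := by
    calc _ ≤ (4 * x + 2) ^ (3 / 4 : ℝ) * (ε / 40 * (4 * x + 2) ^ (1 / 4 : ℝ)) := by gcongr
      _ = _ := by rw [mul_left_comm, h5]
  have h7 := le_abs_self (c * Real.log x)
  nlinarith [mul_le_mul_of_nonneg_left hx hε.le]

theorem stmt15 (C ε : ℝ) (hC : 0 < C) (hε : 0 < ε) :
    ∃ δ : ℝ, 0 < δ ∧ ∃ N : ℕ, ∀ n : ℕ, N ≤ n → ∀ k : ℕ,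
      |(k : ℝ) - 2 * Real.logb 2 n| ≤ C * Real.log (Real.log n) →
      expY n k ≤ (n : ℝ) ^ (1 + δ) →
      grPr n {G | ∃ S : Finset (Fin n), S.card = k + 2 ∧
          (edgesIn G S : ℝ) ≤ (k : ℝ) ^ (3 / 4 : ℝ)} ≤
        (n : ℝ) ^ (-1 + ε) := by
  refine ⟨ε / 2, by positivity, ?_⟩
  have hlog : Filter.Tendsto (fun n : ℕ => Real.log n) Filter.atTop Filter.atTop :=
    Real.tendsto_log_atTop.comp tendsto_natCast_atTop_atTop
  have e1 := hlog.eventually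
    (eventually_rpow_mul_log_add_log_le (2 * C * Real.log 2) (ε / 2) (by positivity))
  have e2 := hlog.eventually ((Real.isLittleO_log_id_atTop.const_mul_left C).def zero_lt_one)
  have e3 := hlog.eventually (Filter.eventually_ge_atTop 1)
  obtain ⟨N, hN⟩ := Filter.eventually_atTop.1 ((e1.and e2).and e3)
  refine ⟨N, fun n hn k hk hY => ?_⟩
  obtain ⟨⟨h1, h2⟩, h3⟩ := hN n hn
  have hn0 : (0 : ℝ) < n := by
    rcases Nat.eq_zero_or_pos n with rfl | h
    · norm_num at h3
    · exact_mod_cast h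
  set x := Real.log n with hx
  have hl2 : 0.6931471803 < Real.log 2 := Real.log_two_gt_d9
  have hlogb : Real.logb 2 n = x / Real.log 2 := rfl
  obtain ⟨hk1, hk2⟩ := abs_le.1 hk
  rw [hlogb] at hk1 hk2
  have h2' : C * Real.log x ≤ x := by
    simp only [id, Real.norm_eq_abs, abs_of_nonneg (show 0 ≤ x by linarith)] at h2
    linarith [le_abs_self (C * Real.log x)]
  have hdiv : x / Real.log 2 ≤ 3 / 2 * x := by
    rw [div_le_iff₀ (by linarith)]
    nlinarith
  have hkx : (k : ℝ) ≤ 4 * x := by linarith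
  have hset : {G : SimpleGraph (Fin n) | ∃ S : Finset (Fin n), S.card = k + 2 ∧
      (edgesIn G S : ℝ) ≤ (k : ℝ) ^ (3 / 4 : ℝ)} =
      {G | ∃ S : Finset (Fin n), S.card = k + 2 ∧ edgesIn G S ≤ ⌊(k : ℝ) ^ (3 / 4 : ℝ)⌋₊} := by
    ext G
    simp only [Set.mem_ofPred_eq, Nat.le_floor_iff (show (0 : ℝ) ≤ (k : ℝ) ^ (3 / 4 : ℝ) by
      positivity)]
  rw [hset]
  refine (grPr_exists_edgesIn_le n (k + 2) _).trans ?_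
  set m := ⌊(k : ℝ) ^ (3 / 4 : ℝ)⌋₊ with hm
  have hmk : (m : ℝ) ≤ (4 * x) ^ (3 / 4 : ℝ) :=
    (Nat.floor_le (by positivity)).trans (Real.rpow_le_rpow (by positivity) hkx (by norm_num))
  have hbase : ((k + 2).choose 2 + 1 : ℝ) ≤ (4 * x + 2) ^ 2 := by
    have : ((k + 2).choose 2 : ℝ) = (k + 2) * (k + 1) / 2 := by
      rw [Nat.cast_choose_two]
      push_cast
      ring
    rw [this]
    have hk0 : (0 : ℝ) ≤ k := Nat.cast_nonneg k
    nlinarith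
  have hM : ((k + 2).choose 2 + 1 : ℝ) ^ m ≤
      Real.exp (2 * (4 * x) ^ (3 / 4 : ℝ) * Real.log (4 * x + 2)) := by
    have hl : 0 ≤ Real.log (4 * x + 2) := Real.log_nonneg (by linarith)
    calc ((k + 2).choose 2 + 1 : ℝ) ^ m ≤ ((4 * x + 2) ^ 2) ^ m := by gcongr
      _ = Real.exp (2 * m * Real.log (4 * x + 2)) := by
        rw [← pow_mul, ← Real.exp_log (show 0 < 4 * x + 2 by linarith), ← Real.exp_nat_mul,
          Real.log_exp]
        push_cast
        ring_nf
      _ ≤ _ := by gcongr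
  have h2k : ((2 : ℝ) ^ (2 * k))⁻¹ ≤ Real.exp (-4 * x + 2 * C * Real.log 2 * Real.log x) := by
    have : (2 : ℝ) ^ (2 * k) = Real.exp (2 * k * Real.log 2) := by
      rw [← Nat.cast_ofNat (n := 2), ← Nat.cast_mul, Real.exp_nat_mul]
      norm_num [Real.exp_log]
    rw [this, ← Real.exp_neg, Real.exp_le_exp]
    have hq : x / Real.log 2 * Real.log 2 = x := div_mul_cancel₀ _ (by linarith)
    nlinarith [mul_le_mul_of_nonneg_right hk1 (show 0 ≤ Real.log 2 by linarith)]
  have hnpow : ∀ y : ℝ, (n : ℝ) ^ y = Real.exp (x * y) := fun y =>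
    Real.rpow_def_of_pos hn0 y
  calc (n.choose (k + 2) : ℝ) * ((k + 2).choose 2 + 1 : ℝ) ^ m / 2 ^ (k + 2).choose 2
      = n.choose (k + 2) / 2 ^ (k + 2).choose 2 * ((k + 2).choose 2 + 1 : ℝ) ^ m := by ring
    _ ≤ expY n k * (n : ℝ) ^ 2 / 2 ^ (2 * k) * ((k + 2).choose 2 + 1 : ℝ) ^ m := by
        exact mul_le_mul_of_nonneg_right (choose_add_two_div_le n k) (by positivity)
    _ = expY n k * (n : ℝ) ^ 2 * (2 ^ (2 * k))⁻¹ * ((k + 2).choose 2 + 1 : ℝ) ^ m := by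
        rw [div_eq_mul_inv]
    _ ≤ Real.exp (x * (1 + ε / 2)) * Real.exp (x * 2) *
        Real.exp (-4 * x + 2 * C * Real.log 2 * Real.log x) *
        Real.exp (2 * (4 * x) ^ (3 / 4 : ℝ) * Real.log (4 * x + 2)) := by
        rw [hnpow] at hY
        have hsq : (n : ℝ) ^ 2 = Real.exp (x * 2) := by
          rw [← hnpow]
          norm_num
        rw [hsq]
        gcongr
    _ ≤ (n : ℝ) ^ (-1 + ε) := by
        rw [hnpow, ← Real.exp_add, ← Real.exp_add, ← Real.exp_add, Real.exp_le_exp]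
        linarith
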